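/- Fix an integer N ≥ 2 and let μ be a non-atomic Borel probability measure on [0,1] such that F_{N,0} is twice continuously differentiable on [0,1]. Define f_{N,n}(x) := (x+N−1)·F'_{N,n}(x) and M_{N,n} := max_{x∈[0,1]} |f'_{N,n}(x)|. Then for every n ∈ ℕ, M_{N,n+1} ≤ q_N · M_{N,n}, where q_N := Σ_{i≥N} (1/i³ + N/(i²(i+1))). -/

import Mathlib

open MeasureTheory Set Filter

/-- The Rényi-type continued fraction transformation
`R_N(x) = N/(1-x) - ⌊N/(1-x)⌋` for `x ≠ 1`, and `R_N(1) = 0`. -/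
noncomputable def renyiMap (N : ℕ) (x : ℝ) : ℝ :=
  if x = 1 then 0 else Int.fract ((N : ℝ) / (1 - x))

/-- `F_{N,n}(x) = μ {y ∈ [0,1] : R_N^n(y) ≤ x}`. -/
noncomputable def Fdist (N : ℕ) (μ : Measure ℝ) (n : ℕ) (x : ℝ) : ℝ :=
  (μ {y ∈ Icc (0 : ℝ) 1 | (renyiMap N)^[n] y ≤ x}).toReal

/-- `f_{N,n}(x) = (x+N-1) F'_{N,n}(x)`. -/
noncomputable def fDens (N : ℕ) (μ : Measure ℝ) (n : ℕ) (x : ℝ) : ℝ :=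
  (x + N - 1) * derivWithin (Fdist N μ n) (Icc 0 1) x

/-- `M_{N,n} = max_{x ∈ [0,1]} |f'_{N,n}(x)|`. -/
noncomputable def Mconst (N : ℕ) (μ : Measure ℝ) (n : ℕ) : ℝ :=
  sSup ((fun x => |derivWithin (fDens N μ n) (Icc 0 1) x|) '' Icc (0 : ℝ) 1)

/-- `q_N = ∑_{i ≥ N} (1/i³ + N/(i²(i+1)))`, written as a sum over `i = j + N`, `j : ℕ`. -/
noncomputable def qConst (N : ℕ) : ℝ :=
  ∑' j : ℕ, (1 / (((j + N : ℕ) : ℝ)) ^ 3 +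
    (N : ℝ) / ((((j + N : ℕ) : ℝ)) ^ 2 * (((j + N : ℕ) : ℝ) + 1)))


/-- The inverse branches `x ↦ 1 - N / (x + i)` of `renyiMap N`, indexed by `i = j + N`. -/
noncomputable def renyiBranch (N j : ℕ) (x : ℝ) : ℝ := 1 - N / (x + j + N)

/-- The weights of the transfer operator acting on `fDens`. -/
noncomputable def renyiWeight (N j : ℕ) (x : ℝ) : ℝ :=
  (x + N - 1) / ((x + j + N) * (x + j + N - 1))

section Arithmetic

/-- Telescoping lower bound for `1 / z ^ 3`. -/
lemma inv_cube_lower {z : ℝ} (hz : 0 < z) :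
    1 / (2 * z ^ 2 - 2 * z + 1) - 1 / (2 * (z + 1) ^ 2 - 2 * (z + 1) + 1) ≤ 1 / z ^ 3 := by
  have h1 : 0 < 2 * z ^ 2 - 2 * z + 1 := by nlinarith [sq_nonneg (z - 1)]
  have h2 : 0 < 2 * (z + 1) ^ 2 - 2 * (z + 1) + 1 := by nlinarith
  rw [div_sub_div _ _ h1.ne' h2.ne', div_le_div_iff₀ (mul_pos h1 h2) (pow_pos hz 3)]
  nlinarith [sq_nonneg z]

lemma inv_sq_remainder {z : ℝ} (hz : 0 < z) :
    1 / z ^ 2 - ((1 / z + 1 / (2 * z ^ 2)) - (1 / (z + 1) + 1 / (2 * (z + 1) ^ 2)))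
      = 1 / (2 * z ^ 2 * (z + 1) ^ 2) := by
  have : z + 1 ≠ 0 := by positivity
  field_simp
  ring

/-- Comparison of `1 / z ^ 2` with `1 / i ^ 2` up to a telescoping term. -/
lemma inv_sq_comparison {i z : ℝ} (hi : 0 < i) (hiz : i ≤ z) :
    1 / z ^ 2 ≤ 1 / i ^ 2
      + ((1 / z + 1 / (2 * z ^ 2)) - (1 / (z + 1) + 1 / (2 * (z + 1) ^ 2)))
      - ((1 / i + 1 / (2 * i ^ 2)) - (1 / (i + 1) + 1 / (2 * (i + 1) ^ 2))) := by
  have hz : 0 < z := hi.trans_le hiz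
  have h : 1 / (2 * z ^ 2 * (z + 1) ^ 2) ≤ 1 / (2 * i ^ 2 * (i + 1) ^ 2) := by gcongr
  linarith [inv_sq_remainder hi, inv_sq_remainder hz]

/-- The telescoping correction in the comparison with the terms of `qConst`. -/
noncomputable def telescopeTerm (N w i z : ℝ) : ℝ :=
  N * (1 / z + 1 / (2 * z ^ 2)) - N * (1 / i + 1 / (2 * i ^ 2))
    - 2 * N * w * (1 / (2 * z ^ 2 - 2 * z + 1)) + N * w * (1 / ((z - 1) * z)) - N * (1 / z)
    - 1 / (2 * i ^ 2 - 2 * i + 1) + N * (1 / i)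

lemma term_le_qterm_add_telescope {N w i z : ℝ} (hN : 0 ≤ N) (hw : 0 ≤ w) (hi : 1 < i)
    (hiz : i ≤ z) :
    N * (z - w) / (z ^ 3 * (z + 1)) + N * w / (z ^ 3 * (z - 1))
      ≤ (1 / i ^ 3 + N / (i ^ 2 * (i + 1)))
        + (telescopeTerm N w i z - telescopeTerm N w (i + 1) (z + 1)) := by
  have hz : 1 < z := hi.trans_le hiz
  have e1 : N * (z - w) / (z ^ 3 * (z + 1)) + N * w / (z ^ 3 * (z - 1))
      = N * (1 / z ^ 2) - 2 * N * w * (1 / z ^ 3)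
        + N * w * (1 / ((z - 1) * z) - 1 / (z * (z + 1))) - N * (1 / z - 1 / (z + 1)) := by
    have h1 : z ≠ 0 := by linarith
    have h2 : z - 1 ≠ 0 := by linarith
    have h3 : z + 1 ≠ 0 := by linarith
    field_simp
    ring
  have e2 : N / (i ^ 2 * (i + 1)) = N * (1 / i ^ 2) - N * (1 / i - 1 / (i + 1)) := by
    have h1 : i ≠ 0 := by linarith
    have h3 : i + 1 ≠ 0 := by linarith
    field_simp
    ring
  have h1 := mul_le_mul_of_nonneg_left (inv_cube_lower (z := z) (by linarith))
    (by positivity : 0 ≤ 2 * N * w)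
  have h2 := mul_le_mul_of_nonneg_left (inv_sq_comparison (by linarith : 0 < i) hiz) hN
  have h3 := inv_cube_lower (z := i) (by linarith)
  have e3 : z + 1 - 1 = z := by ring
  rw [e1, e2, telescopeTerm, telescopeTerm, e3]
  linarith

lemma telescopeTerm_initial_nonpos {N y : ℝ} (hN : 1 < N) (hy : N ≤ y) :
    telescopeTerm N (y - 1) N y ≤ 0 := by
  have hy1 : 1 < y := hN.trans_le hy
  have hDN : 0 < 2 * N ^ 2 - 2 * N + 1 := by nlinarith
  have hDy : 0 < 2 * y ^ 2 - 2 * y + 1 := by nlinarith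
  have hle : 2 * N ^ 2 - 2 * N + 1 ≤ 2 * y ^ 2 - 2 * y + 1 := by nlinarith
  have e : telescopeTerm N (y - 1) N y
      = N * ((1 + 1 / (2 * y ^ 2)) / (2 * y ^ 2 - 2 * y + 1))
        - N * ((1 + 1 / (2 * N ^ 2)) / (2 * N ^ 2 - 2 * N + 1)) := by
    have h1 : y - 1 ≠ 0 := by linarith
    have h2 : y ≠ 0 := by linarith
    have h3 : N ≠ 0 := by linarith
    have h4 := hDN.ne'
    have h5 := hDy.ne'
    unfold telescopeTerm
    generalize hA : 2 * N ^ 2 - 2 * N + 1 = A at *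
    generalize hB : 2 * y ^ 2 - 2 * y + 1 = B at *
    field_simp
    rw [← hA, ← hB]
    ring
  rw [e, sub_nonpos]
  gcongr

lemma tendsto_telescopeTerm (N w i z : ℝ) :
    Tendsto (fun n : ℕ => telescopeTerm N w (i + n) (z + n)) atTop (nhds 0) := by
  have lin (a : ℝ) : Tendsto (fun n : ℕ => a + n) atTop atTop :=
    tendsto_atTop_add_const_left _ _ tendsto_natCast_atTop_atTop
  have inv {f : ℕ → ℝ} (hf : Tendsto f atTop atTop) :
      Tendsto (fun n => 1 / f n) atTop (nhds 0) := by
    simp only [one_div]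
    exact hf.inv_tendsto_atTop
  have inv1 (a : ℝ) : Tendsto (fun n : ℕ => 1 / (a + n)) atTop (nhds 0) := inv (lin a)
  have inv2 (a : ℝ) : Tendsto (fun n : ℕ => 1 / (2 * (a + n) ^ 2)) atTop (nhds 0) := by
    have : Tendsto (fun n : ℕ => 2 * (a + n) ^ 2) atTop atTop :=
      ((tendsto_pow_atTop two_ne_zero).comp (lin a)).const_mul_atTop two_pos
    exact inv this
  have inv3 (a : ℝ) : Tendsto (fun n : ℕ => 1 / (2 * (a + n) ^ 2 - 2 * (a + n) + 1))
      atTop (nhds 0) := by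
    have : Tendsto (fun n : ℕ => 2 * (a + n) ^ 2 - 2 * (a + n) + 1) atTop atTop := by
      refine tendsto_atTop_mono' _ ?_ (lin a)
      filter_upwards [(lin a).eventually_ge_atTop 1] with n hn
      nlinarith
    exact inv this
  have inv4 (a : ℝ) : Tendsto (fun n : ℕ => 1 / ((a + n - 1) * (a + n))) atTop (nhds 0) := by
    have h : Tendsto (fun n : ℕ => a + n - 1) atTop atTop :=
      tendsto_atTop_add_const_right _ (-1) (lin a)
    exact inv (h.atTop_mul_atTop₀ (lin a))
  have := (((((((((inv1 z).add (inv2 z)).const_mul N).sub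
    (((inv1 i).add (inv2 i)).const_mul N)).sub ((inv3 z).const_mul (2 * N * w))).add
    ((inv4 z).const_mul (N * w))).sub ((inv1 z).const_mul N)).sub (inv3 i)).add
    ((inv1 i).const_mul N))
  simpa [telescopeTerm] using this

/-- Partial sums of the sharp contraction coefficient at `x = y - N`. -/
lemma sum_coefficient_le {N y : ℝ} (hN : 1 < N) (hy : N ≤ y) (n : ℕ) :
    ∑ j ∈ Finset.range n, (N * (j + 1) / ((y + j) ^ 3 * (y + j + 1))
        + N * (y - 1) / ((y + j) ^ 3 * (y + j - 1)))
      ≤ ∑ j ∈ Finset.range n, (1 / (N + j) ^ 3 + N / ((N + j) ^ 2 * (N + j + 1)))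
        - telescopeTerm N (y - 1) (N + n) (y + n) := by
  induction n with
  | zero => simpa using telescopeTerm_initial_nonpos hN hy
  | succ n ih =>
    have hn : (0 : ℝ) ≤ n := n.cast_nonneg
    have h := term_le_qterm_add_telescope (N := N) (w := y - 1) (i := N + n) (z := y + n)
      (by linarith) (by linarith) (by linarith) (by linarith)
    have e : y + (n : ℝ) - (y - 1) = n + 1 := by ring
    rw [Finset.sum_range_succ, Finset.sum_range_succ]
    push_cast
    rw [e] at h
    simp only [← add_assoc] at h ⊢
    linarith

lemma summable_qConst_term (N : ℕ) :
    Summable fun j : ℕ => 1 / (((j + N : ℕ) : ℝ)) ^ 3 +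
      (N : ℝ) / ((((j + N : ℕ) : ℝ)) ^ 2 * (((j + N : ℕ) : ℝ) + 1)) := by
  have h3 : Summable fun j : ℕ => 1 / (((j + N : ℕ) : ℝ)) ^ 3 :=
    (summable_nat_add_iff (f := fun j : ℕ => 1 / (j : ℝ) ^ 3) N).2
      (Real.summable_one_div_nat_pow.2 (by norm_num))
  have h2 : Summable fun j : ℕ => (N : ℝ) * (1 / (((j + N : ℕ) : ℝ)) ^ 2) :=
    ((summable_nat_add_iff (f := fun j : ℕ => 1 / (j : ℝ) ^ 2) N).2
      (Real.summable_one_div_nat_pow.2 (by norm_num))).mul_left _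
  refine h3.add (h2.of_nonneg_of_le (fun j => by positivity) fun j => ?_)
  rcases Nat.eq_zero_or_pos (j + N) with h | h
  · simp [h]
  · have : (0 : ℝ) < ((j + N : ℕ) : ℝ) := by exact_mod_cast h
    rw [mul_one_div]
    gcongr
    nlinarith [sq_nonneg ((j + N : ℕ) : ℝ), pow_pos this 3]

end Arithmetic

section Distribution

lemma measurable_renyiMap (N : ℕ) : Measurable (renyiMap N) := by
  unfold renyiMap
  exact Measurable.ite (measurableSet_singleton 1) measurable_const
    (measurable_fract.comp (measurable_const.div (measurable_const.sub measurable_id)))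

lemma renyiMap_mem_Icc (N : ℕ) (x : ℝ) : renyiMap N x ∈ Icc (0 : ℝ) 1 := by
  unfold renyiMap
  split_ifs
  · simp
  · exact ⟨Int.fract_nonneg _, (Int.fract_lt_one _).le⟩

/-- The law of the `n`-th iterate of `renyiMap N` under `μ` restricted to `[0,1]`. -/
noncomputable def renyiLaw (N : ℕ) (μ : Measure ℝ) (n : ℕ) : Measure ℝ :=
  (μ.restrict (Icc 0 1)).map (renyiMap N)^[n]

lemma renyiLaw_succ (N : ℕ) (μ : Measure ℝ) (n : ℕ) :
    renyiLaw N μ (n + 1) = (renyiLaw N μ n).map (renyiMap N) := by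
  rw [renyiLaw, renyiLaw, Measure.map_map (measurable_renyiMap N)
    ((measurable_renyiMap N).iterate n), Function.iterate_succ']

instance isFiniteMeasure_renyiLaw (N : ℕ) (μ : Measure ℝ) [IsFiniteMeasure μ] (n : ℕ) :
    IsFiniteMeasure (renyiLaw N μ n) := by
  unfold renyiLaw
  infer_instance

lemma Fdist_eq_renyiLaw (N : ℕ) (μ : Measure ℝ) (n : ℕ) (x : ℝ) :
    Fdist N μ n x = (renyiLaw N μ n).real (Iic x) := by
  have hm := (measurable_renyiMap N).iterate n
  rw [Fdist, Measure.real, renyiLaw, Measure.map_apply hm measurableSet_Iic,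
    Measure.restrict_apply (hm measurableSet_Iic), inter_comm]
  rfl

lemma renyiLaw_compl_Icc (N : ℕ) (μ : Measure ℝ) (n : ℕ) :
    renyiLaw N μ n (Icc (0 : ℝ) 1)ᶜ = 0 := by
  cases n with
  | zero =>
    rw [renyiLaw, Function.iterate_zero, Measure.map_id,
      Measure.restrict_apply measurableSet_Icc.compl]
    simp
  | succ n =>
    rw [renyiLaw_succ, Measure.map_apply (measurable_renyiMap N) measurableSet_Icc.compl]
    convert! measure_empty (μ := renyiLaw N μ n)
    ext x
    simpa using renyiMap_mem_Icc N x

lemma countable_renyiMap_fiber {N : ℕ} (hN : N ≠ 0) (t : ℝ) :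
    (renyiMap N ⁻¹' {t}).Countable := by
  refine ((countable_singleton (1 : ℝ)).union
    (countable_range fun k : ℤ => 1 - (N : ℝ) / (t + k))).mono fun s hs => ?_
  by_cases h1 : s = 1
  · exact Or.inl h1
  · refine Or.inr ⟨⌊(N : ℝ) / (1 - s)⌋, ?_⟩
    have h2 : 1 - s ≠ 0 := sub_ne_zero.2 (Ne.symm h1)
    have hs' : t = Int.fract ((N : ℝ) / (1 - s)) := by
      simpa [renyiMap, h1] using (mem_singleton_iff.1 hs).symm
    have hN' : (N : ℝ) ≠ 0 := by exact_mod_cast hN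
    simp only [hs', Int.fract_add_floor]
    field_simp
    ring

lemma nullSingletonClass_renyiLaw {N : ℕ} (hN : N ≠ 0) (μ : Measure ℝ) [NullSingletonClass μ]
    (n : ℕ) : NullSingletonClass (renyiLaw N μ n) := by
  induction n with
  | zero =>
    rw [renyiLaw, Function.iterate_zero, Measure.map_id]
    infer_instance
  | succ n ih =>
    refine ⟨fun t => ?_⟩
    rw [renyiLaw_succ, Measure.map_apply (measurable_renyiMap N) (measurableSet_singleton t)]
    exact (countable_renyiMap_fiber hN t).measure_zero _

lemma renyiBranch_one (N j : ℕ) : renyiBranch N j 1 = renyiBranch N (j + 1) 0 := by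
  simp only [renyiBranch]
  push_cast
  ring_nf

lemma renyiBranch_monotone {N j : ℕ} (hN : 2 ≤ N) {x y : ℝ} (hx : -1 < x) (hxy : x ≤ y) :
    renyiBranch N j x ≤ renyiBranch N j y := by
  have : (2 : ℝ) ≤ N := by exact_mod_cast hN
  have hj : (0 : ℝ) ≤ j := j.cast_nonneg
  have : 0 < x + j + N := by linarith
  unfold renyiBranch
  gcongr

lemma pairwise_disjoint_branch {N : ℕ} (hN : 2 ≤ N) {x : ℝ} (hx : x ∈ Icc (0 : ℝ) 1) :
    Pairwise (Function.onFun Disjoint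
      fun j => Ioc (renyiBranch N j 0) (renyiBranch N j x)) := by
  have mono : Monotone fun j => renyiBranch N j 0 := monotone_nat_of_le_succ fun j => by
    rw [← renyiBranch_one]
    exact renyiBranch_monotone hN (by norm_num) zero_le_one
  refine (mono.pairwise_disjoint_on_Ioc_succ).mono fun i j h => h.mono ?_ ?_ <;>
  · refine Ioc_subset_Ioc_right ?_
    rw [Order.succ_eq_add_one, ← renyiBranch_one]
    exact renyiBranch_monotone hN (by linarith [hx.1]) hx.2

/-- Off a countable set, the sublevel sets of `renyiMap N` are unions of branch intervals. -/
lemma renyiMap_le_iff {N : ℕ} (hN : 2 ≤ N) {x t : ℝ} (hx : x ∈ Icc (0 : ℝ) 1)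
    (ht : t ∈ Icc (0 : ℝ) 1) (ht1 : t ≠ 1) (htb : ∀ j, t ≠ renyiBranch N j 0) :
    renyiMap N t ≤ x ↔ t ∈ ⋃ j, Ioc (renyiBranch N j 0) (renyiBranch N j x) := by
  have hN' : (2 : ℝ) ≤ N := by exact_mod_cast hN
  have h1t : 0 < 1 - t := sub_pos.2 (lt_of_le_of_ne ht.2 ht1)
  have key (j : ℕ) (s : ℝ) (hs : 0 ≤ s) :
      t ≤ renyiBranch N j s ↔ (N : ℝ) / (1 - t) ≤ s + j + N := by
    have hj : (0 : ℝ) ≤ j := j.cast_nonneg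
    rw [renyiBranch, le_sub_comm, div_le_iff₀ (by linarith), div_le_iff₀ h1t, mul_comm]
  simp only [mem_iUnion, mem_Ioc, renyiMap, if_neg ht1]
  constructor
  · intro h
    have hfl : (N : ℤ) ≤ ⌊(N : ℝ) / (1 - t)⌋ := by
      rw [Int.le_floor, Int.cast_natCast, le_div_iff₀ h1t]
      nlinarith [ht.1]
    obtain ⟨j, hj⟩ := Int.eq_ofNat_of_zero_le (sub_nonneg.2 hfl)
    have hj' : ((⌊(N : ℝ) / (1 - t)⌋ : ℤ) : ℝ) = j + N := by
      have : ⌊(N : ℝ) / (1 - t)⌋ = (j : ℤ) + N := by omega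
      rw [this]
      push_cast
      rfl
    refine ⟨j, lt_of_le_of_ne ?_ (htb j).symm, (key j x hx.1).2 ?_⟩
    · by_contra hlt
      have h3 := (key j 0 le_rfl).1 (not_le.1 hlt).le
      have h4 := Int.floor_le ((N : ℝ) / (1 - t))
      have h5 : (N : ℝ) / (1 - t) = j + N := by linarith
      refine htb j ?_
      have h6 : (N : ℝ) = (j + N) * (1 - t) := (div_eq_iff h1t.ne').1 h5
      have hj : (0 : ℝ) ≤ j := j.cast_nonneg
      have h7 : (0 : ℝ) + j + N ≠ 0 := by linarith
      rw [renyiBranch, eq_sub_iff_add_eq, ← eq_sub_iff_add_eq', div_eq_iff h7]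
      linarith
    · have := Int.self_sub_floor ((N : ℝ) / (1 - t))
      linarith
  · rintro ⟨j, hj1, hj2⟩
    have h1 := (key j x hx.1).1 hj2
    have h2 := mt (key j 0 le_rfl).2 (not_le.2 hj1)
    rcases hx.2.lt_or_eq with hlt | heq
    · have : ⌊(N : ℝ) / (1 - t)⌋ = (j : ℤ) + N := by
        rw [Int.floor_eq_iff]
        push_cast
        constructor <;> linarith
      rw [Int.fract, this]
      push_cast
      linarith
    · rw [heq]
      exact (Int.fract_lt_one _).le

/-- The Gauss–Kuzmin type recursion for the distribution functions. -/
lemma Fdist_succ {N : ℕ} (hN : 2 ≤ N) (μ : Measure ℝ) [IsFiniteMeasure μ]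
    [NullSingletonClass μ] (n : ℕ) {x : ℝ} (hx : x ∈ Icc (0 : ℝ) 1) :
    Fdist N μ (n + 1) x
      = ∑' j, (Fdist N μ n (renyiBranch N j x) - Fdist N μ n (renyiBranch N j 0)) := by
  have := nullSingletonClass_renyiLaw (N := N) (by omega) μ n
  have hae : renyiMap N ⁻¹' Iic x =ᵐ[renyiLaw N μ n]
      ⋃ j, Ioc (renyiBranch N j 0) (renyiBranch N j x) := by
    have h1 : ∀ᵐ t ∂renyiLaw N μ n, t ∈ Icc (0 : ℝ) 1 := renyiLaw_compl_Icc N μ n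
    have h2 : ∀ᵐ t ∂renyiLaw N μ n, t ≠ 1 := by simp [ae_iff]
    have h3 : ∀ᵐ t ∂renyiLaw N μ n, ∀ j, t ≠ renyiBranch N j 0 :=
      ae_all_iff.2 fun j => by simp [ae_iff]
    filter_upwards [h1, h2, h3] with t h1 h2 h3
    exact propext (renyiMap_le_iff hN hx h1 h2 h3)
  simp only [Fdist_eq_renyiLaw]
  rw [renyiLaw_succ, Measure.real, Measure.map_apply (measurable_renyiMap N) measurableSet_Iic,
    measure_congr hae, measure_iUnion (pairwise_disjoint_branch hN hx)
      (fun _ => measurableSet_Ioc), ENNReal.tsum_toReal_eq (fun _ => measure_ne_top _ _)]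
  refine tsum_congr fun j => ?_
  have hle := renyiBranch_monotone (j := j) hN (by norm_num : (-1 : ℝ) < 0) hx.1
  rw [← Iic_sdiff_Iic, ← Measure.real,
    measureReal_sdiff (Iic_subset_Iic.2 hle) measurableSet_Iic]

end Distribution

section Transfer

/-- A neighbourhood of `[0,1]` mapped into itself by all the inverse branches. -/
def renyiDomain : Set ℝ := Ioo (-1 / 2) (3 / 2)

lemma Icc_subset_renyiDomain : Icc (0 : ℝ) 1 ⊆ renyiDomain :=
  Icc_subset_Ioo (by norm_num) (by norm_num)

lemma renyiBranch_mem_renyiDomain {N j : ℕ} (hN : 2 ≤ N) {x : ℝ} (hx : x ∈ renyiDomain) :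
    renyiBranch N j x ∈ renyiDomain := by
  have hN' : (2 : ℝ) ≤ N := by exact_mod_cast hN
  have hj : (0 : ℝ) ≤ j := j.cast_nonneg
  have hz : 0 < x + j + N := by linarith [hx.1]
  have h1 : 0 < (N : ℝ) / (x + j + N) := by positivity
  have h2 : (N : ℝ) / (x + j + N) < 3 / 2 := by
    rw [div_lt_iff₀ hz]
    linarith [hx.1]
  constructor <;> simp only [renyiBranch] <;> linarith

lemma renyiBranch_mem_Icc {N j : ℕ} (hN : 2 ≤ N) {x : ℝ} (hx : 0 ≤ x) :
    renyiBranch N j x ∈ Icc (0 : ℝ) 1 := by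
  have hN' : (2 : ℝ) ≤ N := by exact_mod_cast hN
  have hj : (0 : ℝ) ≤ j := j.cast_nonneg
  have hz : 0 < x + j + N := by linarith
  have h1 : 0 < (N : ℝ) / (x + j + N) := by positivity
  have h2 : (N : ℝ) / (x + j + N) ≤ 1 := by
    rw [div_le_one hz]
    linarith
  constructor <;> simp only [renyiBranch] <;> linarith

lemma hasDerivAt_renyiBranch {N j : ℕ} {x : ℝ} (hz : x + j + N ≠ 0) :
    HasDerivAt (renyiBranch N j) (N / (x + j + N) ^ 2) x := by
  have h : HasDerivAt (fun x : ℝ => x + j + N) 1 x :=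
    ((hasDerivAt_id x).add_const _).add_const _
  convert! ((hasDerivAt_const x (N : ℝ)).div h hz).const_sub 1 using 1
  field_simp
  ring

lemma hasDerivAt_renyiWeight {N j : ℕ} {x : ℝ} (hz : x + j + N ≠ 0)
    (hz1 : x + j + N - 1 ≠ 0) :
    HasDerivAt (renyiWeight N j)
      (j / (x + j + N - 1) ^ 2 - (j + 1) / (x + j + N) ^ 2) x := by
  have h : HasDerivAt (fun x : ℝ => x + j + N) 1 x :=
    ((hasDerivAt_id x).add_const _).add_const _
  have h0 : HasDerivAt (fun x : ℝ => x + N - 1) 1 x :=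
    ((hasDerivAt_id x).add_const _).sub_const _
  convert! h0.div (h.mul (h.sub_const 1)) (mul_ne_zero hz hz1) using 1
  simp only [Pi.mul_apply]
  field_simp
  ring

/-- A uniform bound for the common factor of all the series below. -/
lemma inv_mul_inv_le {N j : ℕ} (hN : 2 ≤ N) {x : ℝ} (hx : x ∈ renyiDomain) :
    1 / ((x + j + N) * (x + j + N - 1)) ≤ 2 * (1 / ((j : ℝ) + 1) ^ 2) := by
  have hN' : (2 : ℝ) ≤ N := by exact_mod_cast hN
  have hj : (0 : ℝ) ≤ j := j.cast_nonneg
  have hx1 := hx.1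
  rw [mul_one_div, div_le_div_iff₀ (by apply mul_pos <;> linarith) (by positivity)]
  nlinarith

lemma summable_inv_succ_sq : Summable fun j : ℕ => 1 / ((j : ℝ) + 1) ^ 2 := by
  simpa using (summable_nat_add_iff (f := fun j : ℕ => 1 / (j : ℝ) ^ 2) 1).2
    (Real.summable_one_div_nat_pow.2 (by norm_num))

lemma abs_renyiWeight_deriv_le {N j : ℕ} (hN : 2 ≤ N) {x : ℝ} (hx : x ∈ renyiDomain) :
    |j / (x + j + N - 1) ^ 2 - (j + 1) / (x + j + N) ^ 2|
      ≤ 1 / ((x + j + N) * (x + j + N - 1)) := by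
  have hN' : (2 : ℝ) ≤ N := by exact_mod_cast hN
  have hj : (0 : ℝ) ≤ j := j.cast_nonneg
  have hx1 := hx.1
  have hw : 0 < x + N - 1 := by linarith
  have hz : 0 < x + j + N := by linarith
  have hz1 : 0 < x + j + N - 1 := by linarith
  have e : (j : ℝ) / (x + j + N - 1) ^ 2 - (j + 1) / (x + j + N) ^ 2
      = (1 - (x + N - 1) / (x + j + N) - (x + N - 1) / (x + j + N - 1))
        * (1 / ((x + j + N) * (x + j + N - 1))) := by
    field_simp
    ring
  have h1 : (x + N - 1) / (x + j + N) ≤ 1 := by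
    rw [div_le_one hz]
    linarith
  have h2 : (x + N - 1) / (x + j + N - 1) ≤ 1 := by
    rw [div_le_one hz1]
    linarith
  have h3 : 0 ≤ (x + N - 1) / (x + j + N) := by positivity
  have h4 : 0 ≤ (x + N - 1) / (x + j + N - 1) := by positivity
  have h5 : 0 ≤ 1 / ((x + j + N) * (x + j + N - 1)) := by positivity
  rw [e, abs_mul, abs_of_nonneg h5]
  refine mul_le_of_le_one_left h5 (abs_le.2 ⟨?_, ?_⟩) <;> linarith

/-- The derivative of the `j`-th summand of the transfer operator. -/
noncomputable def transferDerivTerm (N : ℕ) (g g' : ℝ → ℝ) (j : ℕ) (x : ℝ) : ℝ :=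
  (j / (x + j + N - 1) ^ 2 - (j + 1) / (x + j + N) ^ 2) * g (renyiBranch N j x)
    + renyiWeight N j x * (g' (renyiBranch N j x) * (N / (x + j + N) ^ 2))

lemma hasDerivAt_transferTerm {N j : ℕ} (hN : 2 ≤ N) {g g' : ℝ → ℝ}
    (hg : ∀ x ∈ renyiDomain, HasDerivAt g (g' x) x) {x : ℝ} (hx : x ∈ renyiDomain) :
    HasDerivAt (fun x => renyiWeight N j x * g (renyiBranch N j x))
      (transferDerivTerm N g g' j x) x := by
  have hN' : (2 : ℝ) ≤ N := by exact_mod_cast hN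
  have hj : (0 : ℝ) ≤ j := j.cast_nonneg
  have hx1 := hx.1
  have hz : x + j + N ≠ 0 := by linarith
  have hz1 : x + j + N - 1 ≠ 0 := by linarith
  exact (hasDerivAt_renyiWeight hz hz1).mul
    ((hg _ (renyiBranch_mem_renyiDomain hN hx)).comp x (hasDerivAt_renyiBranch hz))

lemma abs_transferDerivTerm_le {N j : ℕ} (hN : 2 ≤ N) {g g' : ℝ → ℝ} {B C : ℝ}
    (hB : ∀ x ∈ renyiDomain, |g x| ≤ B) (hC : ∀ x ∈ renyiDomain, |g' x| ≤ C)
    {x : ℝ} (hx : x ∈ renyiDomain) :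
    |transferDerivTerm N g g' j x| ≤ (B + C * N) * (2 * (1 / ((j : ℝ) + 1) ^ 2)) := by
  have hN' : (2 : ℝ) ≤ N := by exact_mod_cast hN
  have hj : (0 : ℝ) ≤ j := j.cast_nonneg
  have hx1 := hx.1
  have hw : 0 < x + N - 1 := by linarith
  have hz : 1 ≤ x + j + N := by linarith
  have hz1 : 0 < x + j + N - 1 := by linarith
  have hu := renyiBranch_mem_renyiDomain (j := j) hN hx
  have hB' := hB _ hu
  have hC' := hC _ hu
  have hB0 := (abs_nonneg _).trans hB'
  have hC0 := (abs_nonneg _).trans hC'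
  set K := 1 / ((x + j + N) * (x + j + N - 1)) with hK
  have hK0 : 0 ≤ K := by positivity
  have hweight : |renyiWeight N j x * (g' (renyiBranch N j x) * (N / (x + j + N) ^ 2))|
      ≤ C * N * K := by
    have e : renyiWeight N j x * (g' (renyiBranch N j x) * (N / (x + j + N) ^ 2))
        = g' (renyiBranch N j x) * (N * ((x + N - 1) / (x + j + N) ^ 2) * K) := by
      rw [renyiWeight, hK]
      field_simp
    have h1 : (x + N - 1) / (x + j + N) ^ 2 ≤ 1 := by
      rw [div_le_one (by positivity)]
      nlinarith
    have h0 : 0 ≤ (x + N - 1) / (x + j + N) ^ 2 := by positivity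
    have h2 : 0 ≤ N * ((x + N - 1) / (x + j + N) ^ 2) * K := by positivity
    rw [e, abs_mul, abs_of_nonneg h2, mul_assoc C]
    gcongr
    exact mul_le_of_le_one_right (by positivity) h1
  have hder := abs_renyiWeight_deriv_le (j := j) hN hx
  calc |transferDerivTerm N g g' j x|
      ≤ K * B + C * N * K := by
        refine (abs_add_le _ _).trans (add_le_add ?_ hweight)
        rw [abs_mul]
        gcongr
    _ = (B + C * N) * K := by ring
    _ ≤ _ := by
        gcongr
        exact inv_mul_inv_le hN hx

lemma hasDerivAt_transfer {N : ℕ} (hN : 2 ≤ N) {g g' : ℝ → ℝ} {B C : ℝ}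
    (hg : ∀ x ∈ renyiDomain, HasDerivAt g (g' x) x)
    (hB : ∀ x ∈ renyiDomain, |g x| ≤ B) (hC : ∀ x ∈ renyiDomain, |g' x| ≤ C)
    {x : ℝ} (hx : x ∈ renyiDomain) :
    HasDerivAt (fun x => ∑' j, renyiWeight N j x * g (renyiBranch N j x))
      (∑' j, transferDerivTerm N g g' j x) x := by
  have h0 : (0 : ℝ) ∈ renyiDomain := Icc_subset_renyiDomain ⟨le_rfl, zero_le_one⟩
  refine hasDerivAt_tsum_of_isPreconnected
    ((summable_inv_succ_sq.mul_left 2).mul_left (B + C * N)) isOpen_Ioo isPreconnected_Ioo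
    (fun j y hy => hasDerivAt_transferTerm hN hg hy)
    (fun j y hy => abs_transferDerivTerm_le hN hB hC hy) h0 ?_ hx
  refine .of_norm_bounded ((summable_inv_succ_sq.mul_left 2).mul_left (N * B)) fun j => ?_
  have hN' : (2 : ℝ) ≤ N := by exact_mod_cast hN
  have hj : (0 : ℝ) ≤ j := j.cast_nonneg
  have hB' := hB _ (renyiBranch_mem_renyiDomain (j := j) hN h0)
  have hB0 := (abs_nonneg _).trans hB'
  have hz1 : 0 < 0 + (j : ℝ) + N - 1 := by linarith
  have hw : 0 ≤ 0 + (N : ℝ) - 1 := by linarith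
  have hK := inv_mul_inv_le (j := j) hN h0
  rw [Real.norm_eq_abs, abs_mul, renyiWeight, div_eq_mul_one_div,
    abs_of_nonneg (by positivity)]
  calc _ ≤ N * (2 * (1 / ((j : ℝ) + 1) ^ 2)) * B := by
        gcongr
        linarith
    _ = _ := by ring

/-- A smooth extension to `renyiDomain` of the distribution function `Fdist N μ n`, together with
a differentiable extension `g` of `fDens N μ n` whose derivative `g'` is bounded. -/
structure IsSmoothExtension (N : ℕ) (μ : Measure ℝ) (n : ℕ) (Φ g g' : ℝ → ℝ) : Prop where
  hasDerivAt_dist : ∀ x ∈ renyiDomain, HasDerivAt Φ (g x / (x + N - 1)) x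
  hasDerivAt_dens : ∀ x ∈ renyiDomain, HasDerivAt g (g' x) x
  bounded : ∃ C, ∀ x ∈ renyiDomain, |g' x| ≤ C
  eqOn : EqOn Φ (Fdist N μ n) (Icc 0 1)

lemma IsSmoothExtension.bounded_dens {N : ℕ} {μ : Measure ℝ} {n : ℕ} {Φ g g' : ℝ → ℝ}
    (h : IsSmoothExtension N μ n Φ g g') : ∃ B, ∀ x ∈ renyiDomain, |g x| ≤ B := by
  obtain ⟨C, hC⟩ := h.bounded
  have h0 : (0 : ℝ) ∈ renyiDomain := Icc_subset_renyiDomain ⟨le_rfl, zero_le_one⟩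
  have hC0 := (abs_nonneg _).trans (hC 0 h0)
  refine ⟨|g 0| + C * 2, fun x hx => ?_⟩
  have h1 : ‖g x - g 0‖ ≤ C * ‖x - 0‖ :=
    (convex_Ioo _ _).norm_image_sub_le_of_norm_hasDerivWithin_le
      (fun y hy => (h.hasDerivAt_dens y hy).hasDerivWithinAt) hC h0 hx
  have h2 : ‖x - 0‖ ≤ 2 := by
    rw [Real.norm_eq_abs, abs_le]
    constructor <;> linarith [hx.1, hx.2]
  have h3 : |g x| ≤ |g 0| + |g x - g 0| := by
    simpa using abs_add_le (g 0) (g x - g 0)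
  have h4 := h1.trans (mul_le_mul_of_nonneg_left h2 hC0)
  rw [Real.norm_eq_abs] at h4
  linarith

lemma IsSmoothExtension.succ {N : ℕ} (hN : 2 ≤ N) {μ : Measure ℝ} [IsFiniteMeasure μ]
    [NullSingletonClass μ] {n : ℕ} {Φ g g' : ℝ → ℝ} (h : IsSmoothExtension N μ n Φ g g') :
    IsSmoothExtension N μ (n + 1)
      (fun x => ∑' j, (Φ (renyiBranch N j x) - Φ (renyiBranch N j 0)))
      (fun x => ∑' j, renyiWeight N j x * g (renyiBranch N j x))
      (fun x => ∑' j, transferDerivTerm N g g' j x) := by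
  obtain ⟨C, hC⟩ := h.bounded
  obtain ⟨B, hB⟩ := h.bounded_dens
  have hN' : (2 : ℝ) ≤ N := by exact_mod_cast hN
  refine ⟨fun x hx => ?_, fun x hx => hasDerivAt_transfer hN h.hasDerivAt_dens hB hC hx,
    ⟨∑' j : ℕ, (B + C * N) * (2 * (1 / ((j : ℝ) + 1) ^ 2)), fun x hx => ?_⟩, fun x hx => ?_⟩
  · have hw : 0 < x + N - 1 := by linarith [hx.1]
    have key := hasDerivAt_tsum_of_isPreconnected (y₀ := (0 : ℝ)) (y := x)
      (g := fun j x => Φ (renyiBranch N j x) - Φ (renyiBranch N j 0))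
      (g' := fun j x => 1 / ((x + j + N) * (x + j + N - 1)) * g (renyiBranch N j x))
      ((summable_inv_succ_sq.mul_left 2).mul_right B) isOpen_Ioo isPreconnected_Ioo
      (fun j y hy => ?_) (fun j y hy => ?_)
      (Icc_subset_renyiDomain ⟨le_rfl, zero_le_one⟩) (by simp) hx
    · convert! key using 1
      rw [← tsum_div_const]
      refine tsum_congr fun j => ?_
      rw [renyiWeight]
      field_simp
    · have hj : (0 : ℝ) ≤ j := j.cast_nonneg
      have hz : y + j + N ≠ 0 := by linarith [hy.1]
      have hz1 : y + j + N - 1 ≠ 0 := by linarith [hy.1]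
      convert! ((h.hasDerivAt_dist _ (renyiBranch_mem_renyiDomain hN hy)).comp y
        (hasDerivAt_renyiBranch hz)).sub_const (Φ (renyiBranch N j 0)) using 1
      have e : renyiBranch N j y + N - 1 = N * (y + j + N - 1) / (y + j + N) := by
        rw [renyiBranch]
        field_simp
        ring
      rw [e]
      field_simp
    · have hj : (0 : ℝ) ≤ j := j.cast_nonneg
      have hz1 : 0 < y + j + N - 1 := by linarith [hy.1]
      have hz : 0 < y + j + N := by linarith
      rw [Real.norm_eq_abs, abs_mul, abs_of_nonneg (by positivity)]
      gcongr
      · exact inv_mul_inv_le hN hy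
      · exact hB _ (renyiBranch_mem_renyiDomain hN hy)
  · exact tsum_of_norm_bounded (f := fun j => transferDerivTerm N g g' j x)
      ((summable_inv_succ_sq.mul_left 2).mul_left (B + C * N)).hasSum
      fun j => abs_transferDerivTerm_le hN hB hC hx
  · rw [Fdist_succ hN μ n hx]
    refine tsum_congr fun j => ?_
    rw [h.eqOn (renyiBranch_mem_Icc hN hx.1), h.eqOn (renyiBranch_mem_Icc hN le_rfl)]

/-- A function that is continuously differentiable on `[0,1]` extends to the real line. -/
lemma exists_hasDerivAt_extension {f d : ℝ → ℝ} (hd : Continuous d)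
    (hf : ∀ x ∈ Icc (0 : ℝ) 1, HasDerivWithinAt f (d x) (Icc 0 1) x) :
    ∃ F : ℝ → ℝ, (∀ x, HasDerivAt F (d x) x) ∧ EqOn F f (Icc 0 1) := by
  have hF (x : ℝ) : HasDerivAt (fun x => f 0 + ∫ t in (0 : ℝ)..x, d t) (d x) x :=
    (intervalIntegral.integral_hasDerivAt_right (hd.intervalIntegrable _ _)
      (hd.stronglyMeasurableAtFilter _ _) hd.continuousAt).const_add _
  refine ⟨_, hF, fun x hx => ?_⟩
  refine eq_of_derivWithin_eq (fun y _ => (hF y).differentiableAt.differentiableWithinAt)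
    (fun y hy => (hf y hy).differentiableWithinAt) (fun y hy => ?_) (by simp) x hx
  have hu := uniqueDiffOn_Icc (zero_lt_one' ℝ) y (Ico_subset_Icc_self hy)
  rw [(hF y).hasDerivWithinAt.derivWithin hu, (hf y (Ico_subset_Icc_self hy)).derivWithin hu]

lemma exists_isSmoothExtension_zero {N : ℕ} (hN : 2 ≤ N) {μ : Measure ℝ}
    (hsmooth : ContDiffOn ℝ 2 (Fdist N μ 0) (Icc 0 1)) :
    ∃ Φ g g', IsSmoothExtension N μ 0 Φ g g' := by
  have hN' : (2 : ℝ) ≤ N := by exact_mod_cast hN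
  have hu := uniqueDiffOn_Icc (zero_lt_one' ℝ)
  set d := derivWithin (Fdist N μ 0) (Icc 0 1) with hd
  have hd1 : ContDiffOn ℝ 1 d (Icc 0 1) := hsmooth.derivWithin hu (by norm_num)
  have hd2 : ContinuousOn (derivWithin d (Icc 0 1)) (Icc 0 1) :=
    hd1.continuousOn_derivWithin hu le_rfl
  set e : ℝ → ℝ := IccExtend zero_le_one ((Icc (0 : ℝ) 1).domRestrict (derivWithin d (Icc 0 1)))
  have he : Continuous e := hd2.domRestrict.Icc_extend'
  obtain ⟨D, hD, hDd⟩ := exists_hasDerivAt_extension (f := d) he fun x hx => by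
    rw [show e x = derivWithin d (Icc 0 1) x from IccExtend_of_mem _ _ hx]
    exact (hd1.differentiableOn one_ne_zero x hx).hasDerivWithinAt
  have hDc : Continuous D := continuous_iff_continuousAt.2 fun x => (hD x).continuousAt
  obtain ⟨Φ, hΦ, hΦF⟩ := exists_hasDerivAt_extension (f := Fdist N μ 0) hDc fun x hx => by
    rw [hDd hx]
    exact (hsmooth.differentiableOn two_ne_zero x hx).hasDerivWithinAt
  refine ⟨Φ, fun x => (x + N - 1) * D x, fun x => D x + (x + N - 1) * e x, ?_, ?_, ?_, hΦF⟩
  · intro x hx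
    have hw : x + N - 1 ≠ 0 := by linarith [hx.1]
    rw [mul_div_cancel_left₀ _ hw]
    exact hΦ x
  · intro x _
    have h0 : HasDerivAt (fun x : ℝ => x + N - 1) 1 x :=
      ((hasDerivAt_id x).add_const _).sub_const _
    convert! h0.mul (hD x) using 1
    rw [one_mul]
  · obtain ⟨C, hC⟩ := (isCompact_Icc (a := (-1 / 2 : ℝ)) (b := 3 / 2)).exists_bound_of_continuousOn
      (f := fun x => D x + (x + N - 1) * e x) (by fun_prop)
    exact ⟨C, fun x hx => hC x (Ioo_subset_Icc_self hx)⟩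

lemma exists_isSmoothExtension {N : ℕ} (hN : 2 ≤ N) {μ : Measure ℝ} [IsFiniteMeasure μ]
    [NullSingletonClass μ] (hsmooth : ContDiffOn ℝ 2 (Fdist N μ 0) (Icc 0 1)) (n : ℕ) :
    ∃ Φ g g', IsSmoothExtension N μ n Φ g g' := by
  induction n with
  | zero => exact exists_isSmoothExtension_zero hN hsmooth
  | succ n ih =>
    obtain ⟨Φ, g, g', h⟩ := ih
    exact ⟨_, _, _, h.succ hN⟩

end Transfer

section Contraction

lemma IsSmoothExtension.derivWithin_fDens {N : ℕ} (hN : 2 ≤ N) {μ : Measure ℝ} {n : ℕ}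
    {Φ g g' : ℝ → ℝ} (h : IsSmoothExtension N μ n Φ g g') {x : ℝ} (hx : x ∈ Icc (0 : ℝ) 1) :
    derivWithin (fDens N μ n) (Icc 0 1) x = g' x := by
  have hN' : (2 : ℝ) ≤ N := by exact_mod_cast hN
  have hu := uniqueDiffOn_Icc (zero_lt_one' ℝ)
  have heq : EqOn (fDens N μ n) g (Icc 0 1) := fun y hy => by
    have hw : y + N - 1 ≠ 0 := by linarith [hy.1]
    have hd := ((h.hasDerivAt_dist y (Icc_subset_renyiDomain hy)).hasDerivWithinAt).congr_of_mem
      (s := Icc 0 1) (fun z hz => (h.eqOn hz).symm) hy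
    rw [fDens, hd.derivWithin (hu y hy), mul_div_cancel₀ _ hw]
  exact ((h.hasDerivAt_dens x (Icc_subset_renyiDomain hx)).hasDerivWithinAt.congr_of_mem
    heq hx).derivWithin (hu x hx)

lemma IsSmoothExtension.abs_le_Mconst {N : ℕ} (hN : 2 ≤ N) {μ : Measure ℝ} {n : ℕ}
    {Φ g g' : ℝ → ℝ} (h : IsSmoothExtension N μ n Φ g g') {x : ℝ} (hx : x ∈ Icc (0 : ℝ) 1) :
    |g' x| ≤ Mconst N μ n := by
  obtain ⟨C, hC⟩ := h.bounded
  rw [← h.derivWithin_fDens hN hx]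
  refine le_csSup ⟨C, ?_⟩ ⟨x, hx, rfl⟩
  rintro _ ⟨y, hy, rfl⟩
  simp only [h.derivWithin_fDens hN hy]
  exact hC y (Icc_subset_renyiDomain hy)

/-- Partial sums of the derivative of the transfer operator, after summation by parts. -/
lemma abs_sum_transferDerivTerm_add_le {N : ℕ} (hN : 2 ≤ N) {g g' : ℝ → ℝ} {M : ℝ}
    (hg : ∀ x ∈ Icc (0 : ℝ) 1, HasDerivAt g (g' x) x)
    (hM : ∀ x ∈ Icc (0 : ℝ) 1, |g' x| ≤ M) {x : ℝ} (hx : 0 ≤ x) (n : ℕ) :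
    |∑ j ∈ Finset.range n, transferDerivTerm N g g' j x
        + n / (x + n + N - 1) ^ 2 * g (renyiBranch N n x)|
      ≤ M * ∑ j ∈ Finset.range n, (N * (j + 1) / ((x + N + j) ^ 3 * (x + N + j + 1))
        + N * (x + N - 1) / ((x + N + j) ^ 3 * (x + N + j - 1))) := by
  have hN' : (2 : ℝ) ≤ N := by exact_mod_cast hN
  induction n with
  | zero => simp
  | succ n ih =>
    have hn : (0 : ℝ) ≤ n := n.cast_nonneg
    have hz : 0 < x + n + N := by linarith
    have hz1 : 0 < x + n + N - 1 := by linarith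
    have hw : 0 < x + N - 1 := by linarith
    have hu := renyiBranch_mem_Icc (j := n) hN hx
    have hu' := renyiBranch_mem_Icc (j := n + 1) hN hx
    have hdiff : renyiBranch N (n + 1) x - renyiBranch N n x
        = N / ((x + n + N) * (x + n + N + 1)) := by
      have : x + (n + 1) + N ≠ 0 := by linarith
      simp only [renyiBranch]
      push_cast
      field_simp
      ring
    have hlip : |g (renyiBranch N (n + 1) x) - g (renyiBranch N n x)|
        ≤ M * (N / ((x + n + N) * (x + n + N + 1))) := by
      have := (convex_Icc (0 : ℝ) 1).norm_image_sub_le_of_norm_hasDerivWithin_le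
        (fun y hy => (hg y hy).hasDerivWithinAt) hM hu hu'
      have hpos : 0 ≤ (N : ℝ) / ((x + n + N) * (x + n + N + 1)) := by positivity
      rwa [hdiff, Real.norm_eq_abs, Real.norm_eq_abs, abs_of_nonneg hpos] at this
    rw [Finset.sum_range_succ, Finset.sum_range_succ, mul_add]
    have e : ∑ j ∈ Finset.range n, transferDerivTerm N g g' j x + transferDerivTerm N g g' n x
          + ((n + 1 : ℕ) : ℝ) / (x + (n + 1 : ℕ) + N - 1) ^ 2 * g (renyiBranch N (n + 1) x)
        = (∑ j ∈ Finset.range n, transferDerivTerm N g g' j x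
            + n / (x + n + N - 1) ^ 2 * g (renyiBranch N n x))
          + ((n + 1) / (x + n + N) ^ 2 * (g (renyiBranch N (n + 1) x) - g (renyiBranch N n x))
            + renyiWeight N n x * (N / (x + n + N) ^ 2) * g' (renyiBranch N n x)) := by
      have : x + ((n + 1 : ℕ) : ℝ) + N - 1 = x + n + N := by
        push_cast
        ring
      rw [this, transferDerivTerm]
      push_cast
      ring
    rw [e]
    refine (abs_add_le _ _).trans (add_le_add ih ((abs_add_le _ _).trans ?_))
    have hweight : 0 ≤ renyiWeight N n x := by
      unfold renyiWeight
      positivity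
    rw [abs_mul, abs_mul, abs_of_nonneg (by positivity : 0 ≤ (n + 1) / (x + n + N) ^ 2),
      abs_of_nonneg (by positivity : 0 ≤ renyiWeight N n x * (N / (x + n + N) ^ 2))]
    calc _ ≤ (n + 1) / (x + n + N) ^ 2 * (M * (N / ((x + n + N) * (x + n + N + 1))))
          + renyiWeight N n x * (N / (x + n + N) ^ 2) * M := by
          gcongr
          exact hM _ hu
      _ = _ := by
          have e1 : x + (N : ℝ) + n = x + n + N := by ring
          rw [e1, renyiWeight]
          field_simp

lemma abs_tsum_transferDerivTerm_le {N : ℕ} (hN : 2 ≤ N) {g g' : ℝ → ℝ} {B M : ℝ} {x : ℝ}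
    (hg : ∀ x ∈ Icc (0 : ℝ) 1, HasDerivAt g (g' x) x)
    (hB : ∀ x ∈ Icc (0 : ℝ) 1, |g x| ≤ B)
    (hM : ∀ x ∈ Icc (0 : ℝ) 1, |g' x| ≤ M) (hx : 0 ≤ x)
    (hsum : Summable fun j => transferDerivTerm N g g' j x) :
    |∑' j, transferDerivTerm N g g' j x| ≤ qConst N * M := by
  have hN' : (2 : ℝ) ≤ N := by exact_mod_cast hN
  have hM0 : 0 ≤ M := (abs_nonneg _).trans (hM 0 ⟨le_rfl, zero_le_one⟩)
  have hB0 : 0 ≤ B := (abs_nonneg _).trans (hB 0 ⟨le_rfl, zero_le_one⟩)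
  have hboundary : Tendsto
      (fun n : ℕ => n / (x + n + N - 1) ^ 2 * g (renyiBranch N n x)) atTop (nhds 0) := by
    have hlim : Tendsto (fun n : ℕ => (1 / ((n : ℝ) + 1)) * B) atTop (nhds 0) := by
      simpa using tendsto_one_div_add_atTop_nhds_zero_nat.mul_const B
    refine squeeze_zero_norm (fun n => ?_) hlim
    have hn : (0 : ℝ) ≤ n := n.cast_nonneg
    rw [norm_mul, Real.norm_eq_abs, Real.norm_eq_abs, abs_of_nonneg (by positivity)]
    refine mul_le_mul ?_ (hB _ (renyiBranch_mem_Icc hN hx)) (abs_nonneg _) (by positivity)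
    rw [div_le_div_iff₀ (pow_pos (by linarith) 2) (by positivity)]
    have : (n + 1 : ℝ) ^ 2 ≤ (x + n + N - 1) ^ 2 := by
      gcongr
      linarith
    nlinarith
  have hleft := (hsum.hasSum.tendsto_sum_nat.add hboundary).abs
  have hright := ((summable_qConst_term N).hasSum.tendsto_sum_nat.sub
    (tendsto_telescopeTerm N (x + N - 1) N (x + N))).mul_const M
  rw [add_zero] at hleft
  rw [sub_zero] at hright
  refine le_of_tendsto_of_tendsto' hleft hright fun n => ?_
  refine (abs_sum_transferDerivTerm_add_le hN hg hM hx n).trans ?_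
  rw [mul_comm M]
  refine mul_le_mul_of_nonneg_right ?_ hM0
  have hcast (j : ℕ) : ((j + N : ℕ) : ℝ) = N + j := by
    push_cast
    ring
  simp only [hcast]
  exact sum_coefficient_le (by linarith) (by linarith) n

end Contraction

theorem Mconst_contraction (N : ℕ) (hN : 2 ≤ N) (μ : Measure ℝ)
    [IsProbabilityMeasure μ] [NullSingletonClass μ] (hsupp : μ (Icc (0 : ℝ) 1)ᶜ = 0)
    (hsmooth : ContDiffOn ℝ 2 (Fdist N μ 0) (Icc 0 1)) :
    ∀ n : ℕ, Mconst N μ (n + 1) ≤ qConst N * Mconst N μ n := by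
  intro n
  obtain ⟨Φ, g, g', h⟩ := exists_isSmoothExtension hN hsmooth n
  obtain ⟨B, hB⟩ := h.bounded_dens
  obtain ⟨C, hC⟩ := h.bounded
  refine csSup_le ((nonempty_Icc.2 zero_le_one).image _) ?_
  rintro _ ⟨x, hx, rfl⟩
  simp only [(h.succ hN).derivWithin_fDens hN hx]
  exact abs_tsum_transferDerivTerm_le hN
    (fun y hy => h.hasDerivAt_dens y (Icc_subset_renyiDomain hy))
    (fun y hy => hB y (Icc_subset_renyiDomain hy)) (fun y hy => h.abs_le_Mconst hN hy) hx.1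
    (.of_norm_bounded ((summable_inv_succ_sq.mul_left 2).mul_left (B + C * N))
      fun j => abs_transferDerivTerm_le hN hB hC (Icc_subset_renyiDomain hx))
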